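/- arXiv:1306.2192 — 7 statements merged into one kernel-verified Lean document; each statement's English description precedes it below -/
import Mathlib

section
/- Let d ≥ 1, let E = EuclideanSpace ℝ (Fin d), and let u : E → E be twice continuously differentiable. If the symmetric part of the derivative of u vanishes everywhere, i.e. for every x ∈ E and all v, w ∈ E one has ⟪(fderiv ℝ u x) v, w⟫ + ⟪v, (fderiv ℝ u x) w⟫ = 0, then there exist a continuous linear map A : E → E that is skew-symmetric (⟪A v, w⟫ = −⟪v, A w⟫ for all v, w) and a vector b ∈ E such that u(x) = A x + b for all x ∈ E. -/
open scoped InnerProductSpace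

section RigidMotion

variable {E : Type*} [NormedAddCommGroup E] [InnerProductSpace ℝ E] {u : E → E}

/-- If the derivative of a `C²` vector field is everywhere skew-symmetric, then its second
derivative vanishes. -/
theorem fderiv_fderiv_eq_zero_of_skew (hu : ContDiff ℝ 2 u)
    (hskew : ∀ x v w : E, ⟪fderiv ℝ u x v, w⟫_ℝ + ⟪v, fderiv ℝ u x w⟫_ℝ = 0) (x : E) :
    fderiv ℝ (fderiv ℝ u) x = 0 := by
  have hdiff : DifferentiableAt ℝ (fderiv ℝ u) x :=
    (hu.fderiv_right (m := 1) (by norm_num)).differentiable one_ne_zero x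
  have hsymm (a v : E) : fderiv ℝ (fderiv ℝ u) x a v = fderiv ℝ (fderiv ℝ u) x v a :=
    (hu.contDiffAt.isSymmSndFDerivAt (by simp)).eq a v
  have hanti (a v w : E) :
      ⟪fderiv ℝ (fderiv ℝ u) x a v, w⟫_ℝ = -⟪fderiv ℝ (fderiv ℝ u) x a w, v⟫_ℝ := by
    have happly (z : E) :
        HasFDerivAt (fun y => fderiv ℝ u y z) ((fderiv ℝ (fderiv ℝ u) x).flip z) x := by
      simpa using hdiff.hasFDerivAt.clm_apply (hasFDerivAt_const z x)
    have hsum := ((happly v).inner ℝ (hasFDerivAt_const w x)).add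
      ((hasFDerivAt_const v x).inner ℝ (happly w))
    have hzero := hsum.unique
      ((hasFDerivAt_const (0 : ℝ) x).congr_of_eventuallyEq (.of_forall fun y => hskew y v w))
    have := congrArg (fun L => L a) hzero
    simp at this
    rw [real_inner_comm v]
    linarith
  ext a v
  refine ext_inner_right ℝ fun w => ?_
  have h₁ := hanti a v w
  have h₂ := hanti w a v
  have h₃ := hanti v w a
  rw [hsymm a w] at h₁
  rw [hsymm w v] at h₂
  rw [hsymm v a] at h₃
  simp only [zero_apply, inner_zero_left]
  linarith

/-- A `C²` vector field with everywhere skew-symmetric derivative is affine. -/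
theorem eq_fderiv_zero_add_of_skew (hu : ContDiff ℝ 2 u)
    (hskew : ∀ x v w : E, ⟪fderiv ℝ u x v, w⟫_ℝ + ⟪v, fderiv ℝ u x w⟫_ℝ = 0) (x : E) :
    u x = fderiv ℝ u 0 x + u 0 := by
  have hconst (y : E) : fderiv ℝ u y = fderiv ℝ u 0 :=
    is_const_of_fderiv_eq_zero (𝕜 := ℝ)
      ((hu.fderiv_right (m := 1) (by norm_num)).differentiable one_ne_zero)
      (fderiv_fderiv_eq_zero_of_skew hu hskew) y 0
  have hu' : Differentiable ℝ u := hu.differentiable two_ne_zero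
  have hsub : u x - fderiv ℝ u 0 x = u 0 - fderiv ℝ u 0 0 :=
    is_const_of_fderiv_eq_zero (𝕜 := ℝ) (f := fun y => u y - fderiv ℝ u 0 y)
      (hu'.sub (fderiv ℝ u 0).differentiable)
      (fun y => by
        have := ((hu' y).hasFDerivAt.sub (fderiv ℝ u 0).hasFDerivAt).fderiv
        rwa [hconst y, sub_self] at this) x 0
  rw [map_zero, sub_zero] at hsub
  rw [← hsub, add_sub_cancel]

end RigidMotion

/-- A twice continuously differentiable vector field on Euclidean space whose
rate-of-deformation tensor (the symmetric part of its derivative) vanishes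
identically is an infinitesimal rigid motion: `u x = A x + b` with `A`
skew-symmetric. -/
theorem rigid_motion_of_symmetric_gradient_eq_zero
    (d : ℕ) (hd : 1 ≤ d)
    (u : EuclideanSpace ℝ (Fin d) → EuclideanSpace ℝ (Fin d))
    (hu : ContDiff ℝ 2 u)
    (hskew : ∀ x v w : EuclideanSpace ℝ (Fin d),
      ⟪(fderiv ℝ u x) v, w⟫_ℝ + ⟪v, (fderiv ℝ u x) w⟫_ℝ = 0) :
    ∃ (A : EuclideanSpace ℝ (Fin d) →L[ℝ] EuclideanSpace ℝ (Fin d))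
      (b : EuclideanSpace ℝ (Fin d)),
      (∀ v w : EuclideanSpace ℝ (Fin d), ⟪A v, w⟫_ℝ = -⟪v, A w⟫_ℝ) ∧
      (∀ x : EuclideanSpace ℝ (Fin d), u x = A x + b) := by
  exact ⟨fderiv ℝ u 0, u 0, fun v w => eq_neg_of_add_eq_zero_left (hskew 0 v w),
    eq_fderiv_zero_add_of_skew hu hskew⟩
end

section
/- Let d ≥ 1, let E = EuclideanSpace ℝ (Fin d), and let u : E → E be twice continuously differentiable with compact support. If for every x ∈ E and all v, w ∈ E one has ⟪(fderiv ℝ u x) v, w⟫ + ⟪v, (fderiv ℝ u x) w⟫ = 0 (i.e. the rate-of-deformation tensor D(u) vanishes identically), then u is identically zero. -/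
open scoped InnerProductSpace

section

variable {E : Type*} [NormedAddCommGroup E] [InnerProductSpace ℝ E]

/-- If the symmetric gradient of `u` vanishes, then the component of `u` along a line is constant
on that line. -/
theorem inner_add_smul_eq_of_symmetric_gradient_eq_zero {u : E → E} (hu : Differentiable ℝ u)
    (hskew : ∀ x v w : E, ⟪(fderiv ℝ u x) v, w⟫_ℝ + ⟪v, (fderiv ℝ u x) w⟫_ℝ = 0)
    (x v : E) (t : ℝ) : ⟪u (x + t • v), v⟫_ℝ = ⟪u x, v⟫_ℝ := by
  have hderiv : ∀ s : ℝ, HasDerivAt (fun s : ℝ => ⟪u (x + s • v), v⟫_ℝ) 0 s := by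
    intro s
    have hline : HasDerivAt (fun s : ℝ => x + s • v) v s := by
      simpa using ((hasDerivAt_id s).smul_const v).const_add x
    have h := ((hu _).hasFDerivAt.comp_hasDerivAt s hline).inner ℝ (hasDerivAt_const s v)
    have hzero : ⟪(fderiv ℝ u (x + s • v)) v, v⟫_ℝ = 0 := by
      have := hskew (x + s • v) v v
      rw [real_inner_comm v] at this
      rw [real_inner_comm v]
      linarith
    simpa [hzero] using h
  simpa using is_const_of_deriv_eq_zero (fun s => (hderiv s).differentiableAt)
    (fun s => (hderiv s).deriv) t 0

/-- A compactly supported map vanishes somewhere on every line. -/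
theorem HasCompactSupport.exists_apply_add_smul_eq_zero {F : Type*} [Zero F] {u : E → F}
    (hu : HasCompactSupport u) (x : E) {v : E} (hv : v ≠ 0) : ∃ t : ℝ, u (x + t • v) = 0 := by
  obtain ⟨R, hR⟩ := hu.isCompact.isBounded.subset_closedBall x
  have hv' : ‖v‖ ≠ 0 := norm_ne_zero_iff.mpr hv
  refine ⟨(|R| + 1) / ‖v‖, image_eq_zero_of_notMem_tsupport fun hmem => ?_⟩
  have h := hR hmem
  rw [mem_closedBall_iff_norm, add_sub_cancel_left, norm_smul, Real.norm_eq_abs, abs_div,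
    abs_norm, div_mul_cancel₀ _ hv', abs_of_nonneg (by positivity)] at h
  linarith [le_abs_self R]

end

/-- A twice continuously differentiable, compactly supported vector field on
Euclidean space whose rate-of-deformation tensor vanishes identically is
identically zero. -/
theorem eq_zero_of_symmetric_gradient_eq_zero_of_compact_support
    (d : ℕ) (hd : 1 ≤ d)
    (u : EuclideanSpace ℝ (Fin d) → EuclideanSpace ℝ (Fin d))
    (hu : ContDiff ℝ 2 u)
    (hsupp : HasCompactSupport u)
    (hskew : ∀ x v w : EuclideanSpace ℝ (Fin d),
      ⟪(fderiv ℝ u x) v, w⟫_ℝ + ⟪v, (fderiv ℝ u x) w⟫_ℝ = 0) :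
    ∀ x : EuclideanSpace ℝ (Fin d), u x = 0 := by
  intro x
  by_contra hx
  obtain ⟨t, ht⟩ := hsupp.exists_apply_add_smul_eq_zero x hx
  have h := inner_add_smul_eq_of_symmetric_gradient_eq_zero
    (hu.differentiable (by norm_num)) hskew x (u x) t
  rw [ht, inner_zero_left] at h
  exact hx (inner_self_eq_zero.mp h.symm)
end

section
/- Let E be a real inner product space, n ≥ 1, and let q, p : ZMod n → E be two closed polygons (cyclically indexed vertex lists) such that q(k+1) ≠ q(k) for every k. Then ∑_{k} (‖p(k+1) − p(k)‖² − ⟪p(k+1) − p(k), q(k+1) − q(k)⟫) / ‖q(k+1) − q(k)‖ ≥ ∑_{k} ‖p(k+1) − p(k)‖ − ∑_{k} ‖q(k+1) − q(k)‖. -/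
open scoped InnerProductSpace

/-- The edgewise inequality: the normalized pairing of `v` with `v - w` dominates
the difference of the norms. -/
theorem norm_sub_norm_le_sq_sub_inner_div_norm
    {E : Type*} [NormedAddCommGroup E] [InnerProductSpace ℝ E] (v : E) {w : E} (hw : w ≠ 0) :
    ‖v‖ - ‖w‖ ≤ (‖v‖ ^ 2 - ⟪v, w⟫_ℝ) / ‖w‖ := by
  rw [le_div_iff₀ (norm_pos_iff.mpr hw)]
  nlinarith [real_inner_le_norm v w, sq_nonneg (‖v‖ - ‖w‖)]

/-- Key monotonicity inequality for closed polygons: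
the discrete Dirichlet pairing of the new polygon `p` with the difference of
the polygons dominates the difference of the total lengths. -/
theorem polygon_dirichlet_pairing_ge_length_diff
    (n : ℕ) [NeZero n] (hn : 1 ≤ n)
    {E : Type*} [NormedAddCommGroup E] [InnerProductSpace ℝ E]
    (q p : ZMod n → E) (hq : ∀ k : ZMod n, q (k + 1) ≠ q k) :
    (∑ k : ZMod n,
        (‖p (k + 1) - p k‖ ^ 2 - ⟪p (k + 1) - p k, q (k + 1) - q k⟫_ℝ) /
          ‖q (k + 1) - q k‖) ≥
      (∑ k : ZMod n, ‖p (k + 1) - p k‖) - ∑ k : ZMod n, ‖q (k + 1) - q k‖ := by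
  rw [ge_iff_le, ← Finset.sum_sub_distrib]
  exact Finset.sum_le_sum fun k _ =>
    norm_sub_norm_le_sq_sub_inner_div_norm _ (sub_ne_zero.mpr (hq k))
end

section
/- Let n ≥ 3 and let q : ZMod n → ℝ² be a closed polygon with q(k+1) ≠ q(k) for all k. Set h(k) = ‖q(k+1) − q(k)‖, τ(k) = (q(k+1) − q(k)) / h(k), and ν(k) = R(τ(k)), where R : ℝ² → ℝ² is the rotation R(a, b) = (b, −a). Suppose that for every k: (i) τ(k) ≠ −τ(k−1), and (ii) the vector τ(k) − τ(k−1) is parallel to h(k−1)·ν(k−1) + h(k)·ν(k) (i.e. their 2×2 determinant vanishes). Then for every k, either τ(k) = τ(k−1) (the two edges at the vertex q(k) are parallel) or h(k) = h(k−1) (the two edges at q(k) have equal length). -/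
/-- Rotation by `-π/2` in the plane: `R(a, b) = (b, -a)`. -/
noncomputable def rot (x : EuclideanSpace ℝ (Fin 2)) : EuclideanSpace ℝ (Fin 2) :=
  (WithLp.equiv 2 (Fin 2 → ℝ)).symm ![x 1, -(x 0)]

/-- The 2×2 determinant of two planar vectors. -/
noncomputable def det2 (u v : EuclideanSpace ℝ (Fin 2)) : ℝ :=
  u 0 * v 1 - u 1 * v 0

/-- The determinant against a rotated vector is minus the inner product. -/
theorem det2_rot (u v : EuclideanSpace ℝ (Fin 2)) : det2 u (rot v) = -inner ℝ u v := by
  simp [det2, rot, PiLp.inner_apply, Fin.sum_univ_two]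
  ring

theorem rot_smul_add_smul (a b : ℝ) (u v : EuclideanSpace ℝ (Fin 2)) :
    rot (a • u + b • v) = a • rot u + b • rot v := by
  ext i
  fin_cases i <;> simp [rot]
  ring

/-- If the difference of two unit vectors is parallel to a combination of their normals,
then the vectors agree or the coefficients agree. -/
theorem eq_or_eq_of_det2_sub_rot_eq_zero {u v : EuclideanSpace ℝ (Fin 2)}
    (hu : ‖u‖ = 1) (hv : ‖v‖ = 1) {a b : ℝ}
    (huv : det2 (u - v) (a • rot v + b • rot u) = 0) : u = v ∨ b = a := by
  rw [← rot_smul_add_smul, det2_rot, neg_eq_zero] at huv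
  simp only [inner_sub_left, inner_add_right, inner_smul_right, real_inner_self_eq_norm_sq,
    hu, hv, real_inner_comm u v] at huv
  have hfactor : (1 - inner ℝ u v) * (b - a) = 0 := by
    linear_combination huv
  rcases mul_eq_zero.mp hfactor with h | h
  · exact .inl ((inner_eq_one_iff_of_norm_eq_one hu hv).mp (sub_eq_zero.mp h).symm)
  · exact .inr (sub_eq_zero.mp h)

/-- Equidistribution property: if at every vertex of a closed planar polygon
the jump of unit tangents is parallel to the weighted vertex normal, then at
every vertex either the two adjacent edges are parallel or they have
equal length. -/
theorem equidistribution_of_tangent_jump_parallel_vertex_normal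
    (n : ℕ) [NeZero n] (hn : 3 ≤ n)
    (q : ZMod n → EuclideanSpace ℝ (Fin 2))
    (hq : ∀ k : ZMod n, q (k + 1) ≠ q k)
    (h : ZMod n → ℝ) (τ ν : ZMod n → EuclideanSpace ℝ (Fin 2))
    (hh : ∀ k, h k = ‖q (k + 1) - q k‖)
    (hτ : ∀ k, τ k = (h k)⁻¹ • (q (k + 1) - q k))
    (hν : ∀ k, ν k = rot (τ k))
    (hnopp : ∀ k : ZMod n, τ k ≠ -τ (k - 1))
    (hpar : ∀ k : ZMod n,
      det2 (τ k - τ (k - 1)) (h (k - 1) • ν (k - 1) + h k • ν k) = 0) :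
    ∀ k : ZMod n, τ k = τ (k - 1) ∨ h k = h (k - 1) := by
  have hunit : ∀ k, ‖τ k‖ = 1 := fun k ↦ by
    have hne : ‖q (k + 1) - q k‖ ≠ 0 := norm_ne_zero_iff.mpr (sub_ne_zero.mpr (hq k))
    rw [hτ, hh, norm_smul, norm_inv, norm_norm, inv_mul_cancel₀ hne]
  intro k
  have hk := hpar k
  rw [hν, hν] at hk
  exact eq_or_eq_of_det2_sub_rot_eq_zero (hunit k) (hunit (k - 1)) hk
end

section
/- Let n ≥ 3 and r > 0, and let q : ZMod n → ℝ² be the regular n-gon q(k) = r·(cos(2πk/n), sin(2πk/n)). Set h = ‖q(k+1) − q(k)‖ (which equals 2 r sin(π/n) for every k), τ(k) = (q(k+1) − q(k)) / h, and ν(k) = R(τ(k)), where R(a, b) = (b, −a). Then, with the constant κ̄ = −1 / (r cos(π/n)), the discrete constant-mean-curvature equation holds at every vertex: τ(k) − τ(k−1) = (κ̄ h / 2) · (ν(k−1) + ν(k)) for all k ∈ ZMod n. -/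
open Real in
/-- The angle `2πk/n` is determined modulo `2π` by the residue class of `k` modulo `n`. -/
theorem ZMod.exists_angle_val_intCast (n : ℕ) [NeZero n] (m : ℤ) :
    ∃ j : ℤ, 2 * π * (((m : ZMod n).val : ℕ) : ℝ) / n = 2 * m * (π / n) - j * (2 * π) := by
  refine ⟨m / n, ?_⟩
  have hn : (n : ℝ) ≠ 0 := NeZero.ne _
  have hv : (((m : ZMod n).val : ℕ) : ℤ) = m - n * (m / n) := by
    rw [ZMod.val_intCast, Int.emod_def]
  have hv' : (((m : ZMod n).val : ℕ) : ℝ) = m - n * ((m / n : ℤ) : ℝ) := by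
    exact_mod_cast congrArg (Int.cast : ℤ → ℝ) hv
  rw [hv']
  field_simp

open Real in
theorem Real.cos_add_two_mul_sub_cos (t a : ℝ) :
    cos (t + 2 * a) - cos t = -(2 * sin a * sin (t + a)) := by
  rw [cos_sub_cos]
  ring_nf

open Real in
theorem Real.sin_add_two_mul_sub_sin (t a : ℝ) :
    sin (t + 2 * a) - sin t = 2 * sin a * cos (t + a) := by
  rw [sin_sub_sin]
  ring_nf

/-- The regular `n`-gon inscribed in the circle of radius `r` has edges of
length `2 r sin(π/n)` and constant discrete mean curvature
`κ̄ = −1/(r cos(π/n))`: at every vertex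
`τ(k) − τ(k−1) = (κ̄ h / 2)(ν(k−1) + ν(k))`. -/
theorem regular_polygon_constant_discrete_curvature
    (n : ℕ) [NeZero n] (hn : 3 ≤ n) (r : ℝ) (hr : 0 < r)
    (q : ZMod n → EuclideanSpace ℝ (Fin 2))
    (hq : ∀ k : ZMod n, q k = r • ((WithLp.equiv 2 (Fin 2 → ℝ)).symm
      ![Real.cos (2 * Real.pi * (k.val : ℝ) / n),
        Real.sin (2 * Real.pi * (k.val : ℝ) / n)]))
    (h : ℝ) (hh : h = 2 * r * Real.sin (Real.pi / n))
    (τ ν : ZMod n → EuclideanSpace ℝ (Fin 2))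
    (hτ : ∀ k, τ k = h⁻¹ • (q (k + 1) - q k))
    (hν : ∀ k, ν k = rot (τ k))
    (κ : ℝ) (hκ : κ = -(1 / (r * Real.cos (Real.pi / n)))) :
    (∀ k : ZMod n, ‖q (k + 1) - q k‖ = h) ∧
    (∀ k : ZMod n, τ k - τ (k - 1) = (κ * h / 2) • (ν (k - 1) + ν k)) := by
  have hn3 : (3 : ℝ) ≤ n := by exact_mod_cast hn
  obtain ⟨a, ha⟩ : ∃ a, a = Real.pi / n := ⟨_, rfl⟩
  rw [← ha] at hh hκ
  have ha0 : 0 < a := by rw [ha]; positivity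
  have ha2 : a < Real.pi / 2 := by
    rw [ha]
    exact div_lt_div_of_pos_left Real.pi_pos two_pos (by linarith)
  have hsin : 0 < Real.sin a := Real.sin_pos_of_pos_of_lt_pi ha0 (by linarith [Real.pi_pos])
  have hcos : 0 < Real.cos a := Real.cos_pos_of_mem_Ioo ⟨by linarith, ha2⟩
  have hpos : 0 < h := by rw [hh]; positivity
  have hq0 (m : ℤ) : q m 0 = r * Real.cos (2 * m * a) := by
    obtain ⟨j, hj⟩ := ZMod.exists_angle_val_intCast n m
    rw [← ha] at hj
    rw [← Real.cos_sub_int_mul_two_pi _ j, ← hj, hq]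
    simp
  have hq1 (m : ℤ) : q m 1 = r * Real.sin (2 * m * a) := by
    obtain ⟨j, hj⟩ := ZMod.exists_angle_val_intCast n m
    rw [← ha] at hj
    rw [← Real.sin_sub_int_mul_two_pi _ j, ← hj, hq]
    simp
  have hd0 (m : ℤ) : (q (m + 1) - q m) 0 = -(h * Real.sin (2 * m * a + a)) := by
    have hnext := hq0 (m + 1)
    push_cast at hnext
    rw [PiLp.sub_apply, hnext, hq0, hh, ← mul_sub,
      show 2 * ((m : ℝ) + 1) * a = 2 * m * a + 2 * a by ring, Real.cos_add_two_mul_sub_cos]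
    ring
  have hd1 (m : ℤ) : (q (m + 1) - q m) 1 = h * Real.cos (2 * m * a + a) := by
    have hnext := hq1 (m + 1)
    push_cast at hnext
    rw [PiLp.sub_apply, hnext, hq1, hh, ← mul_sub,
      show 2 * ((m : ℝ) + 1) * a = 2 * m * a + 2 * a by ring, Real.sin_add_two_mul_sub_sin]
    ring
  have hτ0 (m : ℤ) : τ m 0 = -Real.sin (2 * m * a + a) := by
    rw [hτ, PiLp.smul_apply, hd0, smul_eq_mul]
    field_simp
  have hτ1 (m : ℤ) : τ m 1 = Real.cos (2 * m * a + a) := by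
    rw [hτ, PiLp.smul_apply, hd1, smul_eq_mul]
    field_simp
  have hν0 (k : ZMod n) : ν k 0 = τ k 1 := by simp [hν, rot]
  have hν1 (k : ZMod n) : ν k 1 = -τ k 0 := by simp [hν, rot]
  refine ⟨fun k => ?_, fun k => ?_⟩ <;> obtain ⟨m, rfl⟩ := ZMod.intCast_surjective k
  · rw [EuclideanSpace.norm_eq, Fin.sum_univ_two, hd0, hd1, Real.norm_eq_abs, Real.norm_eq_abs,
      sq_abs, sq_abs, Real.sqrt_eq_iff_mul_self_eq_of_pos hpos]
    linear_combination -h ^ 2 * Real.sin_sq_add_cos_sq (2 * m * a + a)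
  · have hκh : κ * h / 2 = -(Real.sin a / Real.cos a) := by
      rw [hκ, hh]
      field_simp
    have hp0 := hτ0 (m - 1)
    have hp1 := hτ1 (m - 1)
    push_cast at hp0 hp1
    rw [show 2 * ((m : ℝ) - 1) * a + a = 2 * m * a - a by ring] at hp0 hp1
    ext i
    fin_cases i
    · simp only [Fin.zero_eta, PiLp.sub_apply, PiLp.smul_apply, PiLp.add_apply, smul_eq_mul,
        hν0, hκh, hτ0, hτ1, hp0, hp1, Real.sin_add, Real.sin_sub, Real.cos_add, Real.cos_sub]
      field_simp
      ring
    · simp only [Fin.mk_one, PiLp.sub_apply, PiLp.smul_apply, PiLp.add_apply, smul_eq_mul,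
        hν1, hκh, hτ0, hτ1, hp0, hp1, Real.sin_add, Real.sin_sub, Real.cos_add, Real.cos_sub]
      field_simp
      ring
end

section
/- Let d ≥ 1, let α, γ, μ₊, μ₋, r ∈ ℝ with r > 0, and define u : EuclideanSpace ℝ (Fin d) → EuclideanSpace ℝ (Fin d) by u(z) = α ‖z‖^(−d) z. Set λ = γ (d−1) r^(−1) + 2 α (d−1) (μ₊ − μ₋) r^(−d) and κ = −(d−1)/r. Then for every z with ‖z‖ = r, with ν = z/r the outward unit normal to the sphere of radius r, the interfacial stress balance holds: 2 (μ₊ − μ₋) (fderiv ℝ u z)(ν) + λ ν = −γ κ ν. -/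
/-- Euler's identity for the radial field `x ↦ (a * ‖x‖ ^ n) • x`, which is positively homogeneous
of degree `n + 1`. -/
theorem fderiv_norm_zpow_smul_self {E : Type*} [NormedAddCommGroup E] [InnerProductSpace ℝ E]
    (a : ℝ) (n : ℤ) {z : E} (hz : z ≠ 0) :
    fderiv ℝ (fun x : E => (a * ‖x‖ ^ n) • x) z z = (((n : ℝ) + 1) * (a * ‖z‖ ^ n)) • z := by
  have hnz : ‖z‖ ≠ 0 := norm_ne_zero_iff.mpr hz
  have hd : DifferentiableAt ℝ (fun x : E => ‖x‖) z := differentiableAt_id.norm ℝ hz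
  have hpow := (hasDerivAt_zpow n ‖z‖ (Or.inl hnz)).comp_hasFDerivAt z hd.hasFDerivAt
  have hfield := (hpow.const_mul a).smul (hasFDerivAt_id z)
  have heq : fderiv ℝ (fun x : E => (a * ‖x‖ ^ n) • x) z = _ := hfield.fderiv
  have hzpow : ‖z‖ ^ (n - 1) * ‖z‖ = ‖z‖ ^ n := by rw [← zpow_add_one₀ hnz, sub_add_cancel]
  rw [heq]
  simp [hd.fderiv_norm_self, smul_smul, ← add_smul]
  congr 1
  linear_combination a * n * hzpow


/-- Interfacial stress balance for the expanding bubble solution: on the sphere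
of radius `r`, with `ν = z/r`, `λ = γ(d−1)r^(−1) + 2α(d−1)(μ₊ − μ₋)r^(−d)` and
`κ = −(d−1)/r`, one has `2(μ₊ − μ₋)(fderiv u z)ν + λν = −γκν`. -/
theorem expanding_bubble_stress_balance
    (d : ℕ) (hd : 1 ≤ d) (α γ μp μm r : ℝ) (hr : 0 < r)
    (u : EuclideanSpace ℝ (Fin d) → EuclideanSpace ℝ (Fin d))
    (hu : ∀ z : EuclideanSpace ℝ (Fin d), u z = (α * ‖z‖ ^ (-(d : ℤ))) • z)
    (lam κ : ℝ)
    (hlam : lam = γ * ((d : ℝ) - 1) * r⁻¹ +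
      2 * α * ((d : ℝ) - 1) * (μp - μm) * r ^ (-(d : ℤ)))
    (hκ : κ = -(((d : ℝ) - 1) / r))
    (z : EuclideanSpace ℝ (Fin d)) (hz : ‖z‖ = r) :
    (2 * (μp - μm)) • fderiv ℝ u z (r⁻¹ • z) + lam • (r⁻¹ • z) =
      (-(γ * κ)) • (r⁻¹ • z) := by
  have hz0 : z ≠ 0 := norm_ne_zero_iff.mp (hz ▸ hr.ne')
  rw [funext hu, map_smul, fderiv_norm_zpow_smul_self α _ hz0, hz, hlam, hκ]
  simp only [smul_smul, ← add_smul]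
  congr 1
  push_cast
  ring
end

section
/- Let a, b ∈ ℝ² be unit vectors with a + b ≠ 0, let R : ℝ² → ℝ² be the rotation R(x, y) = (y, −x), and let h, g > 0. If the vector a − b is parallel to h·R(a) + g·R(b) (their 2×2 determinant vanishes), then (h − g)·‖a − b‖² = 0; in particular either a = b or h = g. -/
theorem smul_rot_add_smul_rot (a b : EuclideanSpace ℝ (Fin 2)) (h g : ℝ) :
    h • rot a + g • rot b = rot (h • a + g • b) := by
  ext i
  fin_cases i
  · simp [rot]
  · simp [rot]
    ring

/-- For unit vectors, `2 ⟪a - b, h a + g b⟫ = (h - g) ‖a - b‖²`. -/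
theorem two_mul_inner_sub_smul_add_smul {E : Type*} [NormedAddCommGroup E]
    [InnerProductSpace ℝ E] {a b : E} (ha : ‖a‖ = 1) (hb : ‖b‖ = 1) (h g : ℝ) :
    2 * inner ℝ (a - b) (h • a + g • b) = (h - g) * ‖a - b‖ ^ 2 := by
  rw [norm_sub_sq_real, inner_sub_left, inner_add_right, inner_add_right]
  simp only [real_inner_smul_right, real_inner_self_eq_norm_sq, ha, hb, real_inner_comm a b]
  ring

/-- Core vertex computation behind the equidistribution property: if `a`, `b`
are unit vectors with `a + b ≠ 0`, `h, g > 0`, and `a − b` is parallel to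
`h·R(a) + g·R(b)`, then `(h − g)·‖a − b‖² = 0`; in particular `a = b` or
`h = g`. -/
theorem vertex_equidistribution
    (a b : EuclideanSpace ℝ (Fin 2)) (ha : ‖a‖ = 1) (hb : ‖b‖ = 1)
    (hab : a + b ≠ 0) (h g : ℝ) (hh : 0 < h) (hg : 0 < g)
    (hpar : det2 (a - b) (h • rot a + g • rot b) = 0) :
    (h - g) * ‖a - b‖ ^ 2 = 0 ∧ (a = b ∨ h = g) := by
  have key : (h - g) * ‖a - b‖ ^ 2 = 0 := by
    rw [smul_rot_add_smul_rot, det2_rot, neg_eq_zero] at hpar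
    rw [← two_mul_inner_sub_smul_add_smul ha hb, hpar, mul_zero]
  refine ⟨key, ?_⟩
  rcases mul_eq_zero.mp key with hz | hz
  · exact Or.inr (sub_eq_zero.mp hz)
  · exact Or.inl (sub_eq_zero.mp (norm_eq_zero.mp (pow_eq_zero_iff two_ne_zero |>.mp hz)))
end
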